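/- arXiv:1706.08623 — 3 statements merged into one kernel-verified Lean document; each statement's English description precedes it below -/
import Mathlib

section
/- For every real λ > 1 and x > 0, the doubly infinite series ∑_{n ∈ ℤ} λ^{2n} x / ( (λ^{2n} x + λ)(λ^{2n+1} x + 1) ) converges absolutely and its sum equals 1/(λ² − 1). -/
open Filter Topology

/-- The increments of a monotone function on `ℤ` sum to the difference of its limits. -/
theorem Monotone.hasSum_int_add_one_sub {g : ℤ → ℝ} {a b : ℝ} (hg : Monotone g)
    (ha : Tendsto g atTop (𝓝 a)) (hb : Tendsto g atBot (𝓝 b)) :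
    HasSum (fun n => g (n + 1) - g n) (a - b) := by
  have h_nonneg (n : ℤ) : 0 ≤ g (n + 1) - g n := sub_nonneg.2 (hg (by lia))
  have h_pos : HasSum (fun n : ℕ => g ((n : ℤ) + 1) - g n) (a - g 0) := by
    rw [hasSum_iff_tendsto_nat_of_nonneg fun n => h_nonneg n]
    have h_sum (N : ℕ) : ∑ n ∈ Finset.range N, (g ((n : ℤ) + 1) - g n) = g N - g 0 := by
      simpa using Finset.sum_range_sub (fun n : ℕ => g n) N
    simpa only [h_sum, Function.comp_def] using (ha.comp tendsto_natCast_atTop_atTop).sub_const (g 0)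
  have h_neg : HasSum (fun n : ℕ => g (-((n : ℤ) + 1) + 1) - g (-((n : ℤ) + 1))) (g 0 - b) := by
    rw [hasSum_iff_tendsto_nat_of_nonneg fun n => h_nonneg _]
    have h_sum (N : ℕ) : ∑ n ∈ Finset.range N, (g (-((n : ℤ) + 1) + 1) - g (-((n : ℤ) + 1))) =
        g 0 - g (-N) := by
      simpa using Finset.sum_range_sub' (fun n : ℕ => g (-n)) N
    simpa only [h_sum, Function.comp_def] using
      (hb.comp (tendsto_neg_atTop_atBot.comp tendsto_natCast_atTop_atTop)).const_sub (g 0)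
  simpa using HasSum.of_nat_of_neg_add_one (f := fun n => g (n + 1) - g n) h_pos h_neg

/-- A two-sided geometric progression with ratio above one tends to infinity. -/
theorem tendsto_zpow_atTop_atTop_of_one_lt {r : ℝ} (hr : 1 < r) :
    Tendsto (fun n : ℤ => r ^ n) atTop atTop := by
  refine tendsto_atTop_atTop_of_monotone (zpow_right_strictMono₀ hr).monotone fun b => ?_
  obtain ⟨n, hn⟩ := pow_unbounded_of_one_lt b hr
  exact ⟨n, by simpa using hn.le⟩

/-- A two-sided geometric progression with ratio above one tends to zero on the left. -/
theorem tendsto_zpow_atBot_zero_of_one_lt {r : ℝ} (hr : 1 < r) :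
    Tendsto (fun n : ℤ => r ^ n) atBot (𝓝 0) := by
  simpa [Function.comp_def, Pi.inv_def] using
    ((tendsto_zpow_atTop_atTop_of_one_lt hr).comp tendsto_neg_atBot_atTop).inv_tendsto_atTop

/-- for `λ > 1` and `x > 0`, the doubly infinite series
`∑_{n ∈ ℤ} λ^{2n} x / ((λ^{2n} x + λ)(λ^{2n+1} x + 1))` converges absolutely
and its sum equals `1/(λ² − 1)`. -/
theorem telescoping_series_one
    (lam x : ℝ) (hlam : 1 < lam) (hx : 0 < x) :
    Summable (fun n : ℤ =>
      |lam ^ (2 * n) * x / ((lam ^ (2 * n) * x + lam) * (lam ^ (2 * n + 1) * x + 1))|) ∧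
    ∑' n : ℤ, lam ^ (2 * n) * x / ((lam ^ (2 * n) * x + lam) * (lam ^ (2 * n + 1) * x + 1))
      = 1 / (lam ^ 2 - 1) := by
  have h_lam : 0 < lam := by linarith
  have h_sq : 1 < lam ^ 2 := one_lt_pow₀ hlam two_ne_zero
  set u : ℤ → ℝ := fun n => (lam ^ 2) ^ n * x with hu
  have h_upos (n : ℤ) : 0 < u n := by positivity
  have h_mono : Monotone u := (zpow_right_strictMono₀ h_sq).monotone.mul_const hx.le
  have h_top : Tendsto u atTop atTop :=
    (tendsto_zpow_atTop_atTop_of_one_lt h_sq).atTop_mul_const hx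
  have h_bot : Tendsto u atBot (𝓝 0) := by
    simpa using (tendsto_zpow_atBot_zero_of_one_lt h_sq).mul_const x
  set g : ℤ → ℝ := fun n => u n / (u n + lam) with hg
  have hg_mono : Monotone g := fun m n hmn => by
    have := h_upos m
    have := h_upos n
    have := mul_le_mul_of_nonneg_right (h_mono hmn) h_lam.le
    simp only [hg]
    rw [div_le_div_iff₀ (by positivity) (by positivity)]
    linarith
  have hg_top : Tendsto g atTop (𝓝 1) := by
    have h_eq : g = fun n => 1 - lam / (u n + lam) := funext fun n => by
      have := h_upos n
      simp only [hg]
      field_simp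
      ring
    rw [h_eq]
    simpa using ((tendsto_atTop_add_const_right _ lam h_top).const_div_atTop lam).const_sub 1
  have hg_bot : Tendsto g atBot (𝓝 0) := by
    simpa [hg, Pi.div_def] using h_bot.div (h_bot.add_const lam) (by simpa using h_lam.ne')
  have h_term (n : ℤ) :
      lam ^ (2 * n) * x / ((lam ^ (2 * n) * x + lam) * (lam ^ (2 * n + 1) * x + 1)) =
        (g (n + 1) - g n) / (lam ^ 2 - 1) := by
    have h_even : lam ^ (2 * n) * x = u n := by simp [hu, zpow_mul]
    have h_odd : lam ^ (2 * n + 1) * x = lam * u n := by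
      rw [zpow_add_one₀ h_lam.ne', ← h_even]
      ring
    have h_succ : u (n + 1) = lam ^ 2 * u n := by
      simp only [hu]
      rw [zpow_add_one₀ (by positivity)]
      ring
    have := h_upos n
    have h_ne : lam ^ 2 - 1 ≠ 0 := by linarith
    have h_next : g (n + 1) = lam * u n / (lam * u n + 1) := by
      simp only [hg, h_succ]
      field_simp
    rw [h_even, h_odd, h_next]
    simp only [hg]
    field_simp
    ring
  have h_sum := (hg_mono.hasSum_int_add_one_sub hg_top hg_bot).div_const (lam ^ 2 - 1)
  simp only [h_term]
  exact ⟨h_sum.summable.abs, by simpa using h_sum.tsum_eq⟩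
end

section
/- Summation of the Melnikov series for the time-dependent ellipse (elementary form of formula (25) of Theorem 1.2): let a > b > 0, c = sqrt(a² − b²), λ = (a+c)/(a−c), h = log λ, let v > 0 and da, db ∈ ℝ, and for τ ∈ ℝ put w = e^{2τ} and define F(τ) = [ −8·da·c²·λ(λ+1)·w(λ²−w)² ] / [ v(1+w)(w+λ³)(w+λ²)² ] + [ 16·db·a·c²·λ²·w(λ−w)(λ²−w) ] / [ b·v(1+w)(w+λ³)(w+λ²)² ] − [ 16·a²·c·λ²·(da·b/a − db)·w(λ²−w)(λ+w) ] / [ v·b(λ³+w)(λ²+w)²(w+1) ] + [ 8·a·c·λ·w( −da(λ+1)(λ²−w) + 2λ·db·(a/b)(λ−w) ) ] / [ v(w+λ³)(w+λ²)(w+1) ] + [ 16·c²·λ²·w( da·b(λ²−w)² + 4·db·a·λ²·w ) ] / [ v·b(w+λ³)(w+λ²)²(w+λ) ] + [ 16·a²·λ²·w(a·db/b − da)(w+λ) ] / [ v(w+λ³)(w+λ²)(w+1) ]. Then for every τ ∈ ℝ both doubly infinite series below converge absolutely and ∑_{n ∈ ℤ} F(τ + n h) = (4b(a·db − b·da)/v)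 · ∑_{n ∈ ℤ} sech²(τ + n h). -/
/-- The summand `F(τ)` of the Melnikov series `M₁` for the time-dependent ellipse,
written on the separatrix branch `W₂` in the variable `τ` (with `w = e^{2τ}`,
`e^τ = tan(φ/2)`), so that consecutive collisions correspond to `τ ↦ τ + h`. -/
noncomputable def melnikovSummand (a b c lam v da db τ : ℝ) : ℝ :=
  let w := Real.exp (2 * τ)
  (-8 * da * c ^ 2 * lam * (lam + 1) * w * (lam ^ 2 - w) ^ 2) /
      (v * (1 + w) * (w + lam ^ 3) * (w + lam ^ 2) ^ 2)
  + (16 * db * a * c ^ 2 * lam ^ 2 * w * (lam - w) * (lam ^ 2 - w)) /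
      (b * v * (1 + w) * (w + lam ^ 3) * (w + lam ^ 2) ^ 2)
  - (16 * a ^ 2 * c * lam ^ 2 * (da * b / a - db) * w * (lam ^ 2 - w) * (lam + w)) /
      (v * b * (lam ^ 3 + w) * (lam ^ 2 + w) ^ 2 * (w + 1))
  + (8 * a * c * lam * w *
        (-da * (lam + 1) * (lam ^ 2 - w) + 2 * lam * db * (a / b) * (lam - w))) /
      (v * (w + lam ^ 3) * (w + lam ^ 2) * (w + 1))
  + (16 * c ^ 2 * lam ^ 2 * w * (da * b * (lam ^ 2 - w) ^ 2 + 4 * db * a * lam ^ 2 * w)) /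
      (v * b * (w + lam ^ 3) * (w + lam ^ 2) ^ 2 * (w + lam))
  + (16 * a ^ 2 * lam ^ 2 * w * (a * db / b - da) * (w + lam)) /
      (v * (w + lam ^ 3) * (w + lam ^ 2) * (w + 1))

theorem sech_sq_eq_exp (x : ℝ) :
    (Real.cosh x ^ 2)⁻¹ = 4 * Real.exp (2 * x) / (1 + Real.exp (2 * x)) ^ 2 := by
  have he : Real.exp (2 * x) = Real.exp x ^ 2 := by rw [← Real.exp_nat_mul]; norm_num
  rw [Real.cosh_eq, Real.exp_neg, he]
  have := Real.exp_pos x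
  field_simp
  ring

theorem sech_sq_le_exp_neg (x : ℝ) : (Real.cosh x ^ 2)⁻¹ ≤ 4 * Real.exp (-(2 * x)) := by
  have := Real.exp_pos (2 * x)
  rw [sech_sq_eq_exp, Real.exp_neg, ← div_eq_mul_inv, div_le_div_iff₀ (by positivity) this]
  nlinarith

theorem summable_sech_sq {h : ℝ} (hh : 0 < h) (τ : ℝ) :
    Summable (fun n : ℤ => (Real.cosh (τ + n * h) ^ 2)⁻¹) := by
  have key (σ : ℝ) : Summable (fun n : ℕ => (Real.cosh (σ + n * h) ^ 2)⁻¹) := by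
    have hgeom : Summable (fun n : ℕ => Real.exp (-(2 * h)) ^ n) :=
      summable_geometric_of_lt_one (Real.exp_pos _).le (by rw [Real.exp_lt_one_iff]; linarith)
    refine Summable.of_nonneg_of_le (fun n => by positivity) (fun n => ?_)
      (hgeom.mul_left (4 * Real.exp (-(2 * σ))))
    refine (sech_sq_le_exp_neg _).trans_eq ?_
    rw [← Real.exp_nat_mul, mul_assoc, ← Real.exp_add]
    ring_nf
  refine Summable.of_nat_of_neg (by simpa using key τ) ?_
  refine (key (-τ)).congr fun n => ?_
  rw [← Real.cosh_neg]
  push_cast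
  ring_nf

/-- The simple-pole part of the summand is a difference of two consecutive values of a multiple of
this function. -/
noncomputable def melnikovPotential (lam τ : ℝ) : ℝ :=
  Real.exp (2 * τ) / ((1 + Real.exp (2 * τ)) * (Real.exp (2 * τ) + lam))

theorem summable_melnikovPotential {lam h : ℝ} (hlam : 1 ≤ lam) (hh : 0 < h) (τ : ℝ) :
    Summable (fun n : ℤ => melnikovPotential lam (τ + n * h)) := by
  refine Summable.of_nonneg_of_le (fun n => ?_) (fun n => ?_) (summable_sech_sq hh τ)
  · unfold melnikovPotential
    positivity
  · rw [sech_sq_eq_exp, melnikovPotential]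
    generalize hw : Real.exp (2 * (τ + n * h)) = w
    have : 0 < w := hw ▸ Real.exp_pos _
    gcongr ?_ / ?_
    · linarith
    · nlinarith

theorem melnikovSummand_partial_fractions {r s : ℝ} (hr : 1 < r) (hs : 0 < s) {v : ℝ} (hv : 0 < v)
    (da db τ : ℝ) :
    melnikovSummand ((r ^ 2 + 1) * s) (2 * r * s) ((r ^ 2 - 1) * s) (r ^ 2) v da db τ =
      4 * (2 * r * s) * ((r ^ 2 + 1) * s * db - 2 * r * s * da) / v *
          (Real.cosh (τ - Real.log (r ^ 2)) ^ 2)⁻¹ +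
        16 * r ^ 2 * s ^ 2 * (2 * r * db - (r ^ 2 + 1) * da) / v *
          (melnikovPotential (r ^ 2) τ - melnikovPotential (r ^ 2) (τ - Real.log (r ^ 2))) := by
  have hexp : Real.exp (2 * (τ - Real.log (r ^ 2))) = Real.exp (2 * τ) / r ^ 4 := by
    rw [mul_sub, Real.exp_sub, two_mul (Real.log _), Real.exp_add, Real.exp_log (by positivity)]
    ring
  rw [sech_sq_eq_exp]
  unfold melnikovSummand melnikovPotential
  rw [hexp]
  generalize hw : Real.exp (2 * τ) = w
  have : 0 < w := hw ▸ Real.exp_pos _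
  have h1 : 1 + w ≠ 0 := by positivity
  have h2 : w + 1 ≠ 0 := by positivity
  field_simp
  ring

/-- summation of the Melnikov series for the time-dependent ellipse.
For every `τ` the doubly infinite series `∑_{n ∈ ℤ} F(τ + n h)` and
`∑_{n ∈ ℤ} sech²(τ + n h)` converge absolutely and
`∑_{n ∈ ℤ} F(τ + n h) = (4b(a·db − b·da)/v) ∑_{n ∈ ℤ} sech²(τ + n h)`. -/
theorem melnikov_series_summation
    (a b : ℝ) (hb : 0 < b) (hab : b < a)
    (c lam h : ℝ) (hc : c = Real.sqrt (a ^ 2 - b ^ 2)) (hlam : lam = (a + c) / (a - c))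
    (hh : h = Real.log lam)
    (v : ℝ) (hv : 0 < v) (da db : ℝ) :
    ∀ τ : ℝ,
      Summable (fun n : ℤ => |melnikovSummand a b c lam v da db (τ + n * h)|) ∧
      Summable (fun n : ℤ => |(Real.cosh (τ + n * h) ^ 2)⁻¹|) ∧
      ∑' n : ℤ, melnikovSummand a b c lam v da db (τ + n * h)
        = (4 * b * (a * db - b * da) / v) * ∑' n : ℤ, (Real.cosh (τ + n * h) ^ 2)⁻¹ := by
  intro τ
  have ha : 0 < a := hb.trans hab
  have hc2 : c ^ 2 = a ^ 2 - b ^ 2 := by rw [hc, Real.sq_sqrt]; nlinarith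
  have hc0 : 0 < c := by rw [hc]; exact Real.sqrt_pos.mpr (by nlinarith)
  have hca : 0 < a - c := by nlinarith
  obtain ⟨r, hr⟩ : ∃ r, r = (a + c) / b := ⟨_, rfl⟩
  obtain ⟨s, hs⟩ : ∃ s, s = (a - c) / 2 := ⟨_, rfl⟩
  have hr1 : 1 < r := by rw [hr, one_lt_div hb]; linarith
  have hs0 : 0 < s := by rw [hs]; linarith
  have hlr : lam = r ^ 2 := by
    rw [hlam, hr]
    field_simp
    linear_combination hc2
  have hlam' : lam * (a - c) = a + c := by rw [hlam]; field_simp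
  have hl1 : 1 < lam := by rw [hlr]; nlinarith
  have hh0 : 0 < h := hh ▸ Real.log_pos hl1
  have ea : a = (r ^ 2 + 1) * s := by rw [← hlr, hs]; linear_combination -hlam' / 2
  have ec : c = (r ^ 2 - 1) * s := by rw [← hlr, hs]; linear_combination -hlam' / 2
  have eb : b = 2 * r * s := by
    rw [hr, hs]
    field_simp
    linear_combination hc2
  have hS := summable_sech_sq hh0
  have hG := summable_melnikovPotential hl1.le hh0
  obtain ⟨K, hK⟩ : ∃ K, K = 4 * b * (a * db - b * da) / v := ⟨_, rfl⟩
  obtain ⟨q, hq⟩ : ∃ q, q = 16 * r ^ 2 * s ^ 2 * (2 * r * db - (r ^ 2 + 1) * da) / v := ⟨_, rfl⟩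
  have hF (n : ℤ) : melnikovSummand a b c lam v da db (τ + n * h) =
      K * (Real.cosh (τ + (n - 1 : ℤ) * h) ^ 2)⁻¹ +
        q * (melnikovPotential lam (τ + n * h) - melnikovPotential lam (τ + (n - 1 : ℤ) * h)) := by
    have hn : τ + ((n - 1 : ℤ) : ℝ) * h = τ + n * h - Real.log (r ^ 2) := by
      rw [← hlr, ← hh]
      push_cast
      ring
    rw [hn, hK, hq, hlr, ea, eb, ec]
    exact melnikovSummand_partial_fractions hr1 hs0 hv da db _
  have shift {f : ℤ → ℝ} {x : ℝ} (hf : HasSum f x) : HasSum (fun n => f (n - 1)) x :=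
    (Equiv.subRight (1 : ℤ)).hasSum_iff.mpr hf
  have hsum : HasSum (fun n : ℤ => melnikovSummand a b c lam v da db (τ + n * h))
      (K * ∑' n : ℤ, (Real.cosh (τ + n * h) ^ 2)⁻¹) := by
    have := ((shift (hS τ).hasSum).mul_left K).add
      (((hG τ).hasSum.sub (shift (hG τ).hasSum)).mul_left q)
    rw [sub_self, mul_zero, add_zero] at this
    exact this.congr_fun hF
  exact ⟨hsum.summable.abs, (hS τ).abs, hK ▸ hsum.tsum_eq⟩
end

section
/- Vanishing criterion for the Melnikov function of the time-dependent ellipse (Theorem 1.2, zero set): with the data and the function F of the previous statement, let M₁(τ) = ∑_{n ∈ ℤ} F(τ + n h). If a·db − b·da = 0 then M₁ vanishes identically; and if a·db − b·da ≠ 0 then M₁(τ) ≠ 0 for every τ ∈ ℝ, with the sign of M₁(τ) equal to the sign of (a·db − b·da). Consequently, the Melnikov function has zeros only at times t* at which d/dt (a(t)/b(t)) = 0, for all values of energy and reflection angle. -/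
open Filter Topology

/-- A bounded decreasing two-sided sequence telescopes to the difference of its limits. -/
lemma hasSum_int_sub_succ_of_antitone {f : ℤ → ℝ} (hf : Antitone f) {A B : ℝ}
    (hA : Tendsto f atBot (𝓝 A)) (hB : Tendsto f atTop (𝓝 B)) :
    HasSum (fun n : ℤ => f n - f (n + 1)) (A - B) := by
  have h_pos : HasSum (fun n : ℕ => f n - f (n + 1)) (f 0 - B) := by
    rw [hasSum_iff_tendsto_nat_of_nonneg (fun n => sub_nonneg.2 (hf (by lia)))]
    have hsum : ∀ n : ℕ, ∑ i ∈ Finset.range n, (f i - f (i + 1)) = f 0 - f n := fun n => by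
      simpa using Finset.sum_range_sub' (fun i : ℕ => f i) n
    simp_rw [hsum]
    exact (hB.comp tendsto_natCast_atTop_atTop).const_sub _
  have h_neg : HasSum (fun n : ℕ => f (-(n + 1 : ℤ)) - f (-(n + 1 : ℤ) + 1)) (A - f 0) := by
    rw [hasSum_iff_tendsto_nat_of_nonneg (fun n => sub_nonneg.2 (hf (by lia)))]
    have hsum : ∀ n : ℕ, ∑ i ∈ Finset.range n, (f (-(i + 1 : ℤ)) - f (-(i + 1 : ℤ) + 1))
        = f (-n) - f 0 := fun n => by
      simpa using Finset.sum_range_sub (fun i : ℕ => f (-(i : ℤ))) n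
    simp_rw [hsum]
    exact (hA.comp (tendsto_neg_atTop_atBot.comp tendsto_natCast_atTop_atTop)).sub_const _
  have h := HasSum.of_nat_of_neg_add_one (f := fun n : ℤ => f n - f (n + 1)) h_pos h_neg
  rwa [show f 0 - B + (A - f 0) = A - B by ring] at h

/-- The positive kernel `w / ((1 + w) (w + λ²))` with `w = e^{2τ}`. -/
noncomputable def melnikovKernel (lam τ : ℝ) : ℝ :=
  Real.exp (2 * τ) / ((1 + Real.exp (2 * τ)) * (Real.exp (2 * τ) + lam ^ 2))

/-- The positive correction `w² λ² / ((w + λ³) (w + λ²)² (w + λ))` with `w = e^{2τ}`. -/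
noncomputable def melnikovCorrection (lam τ : ℝ) : ℝ :=
  Real.exp (2 * τ) ^ 2 * lam ^ 2 /
    ((Real.exp (2 * τ) + lam ^ 3) * (Real.exp (2 * τ) + lam ^ 2) ^ 2 * (Real.exp (2 * τ) + lam))

lemma melnikovKernel_pos {lam : ℝ} (hlam : 0 < lam) (τ : ℝ) : 0 < melnikovKernel lam τ := by
  unfold melnikovKernel; positivity

lemma melnikovCorrection_nonneg {lam : ℝ} (hlam : 0 < lam) (τ : ℝ) :
    0 ≤ melnikovCorrection lam τ := by
  unfold melnikovCorrection; positivity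

lemma melnikovCorrection_le_kernel {lam : ℝ} (hlam : 1 < lam) (τ : ℝ) :
    melnikovCorrection lam τ ≤ melnikovKernel lam τ := by
  unfold melnikovCorrection melnikovKernel
  have hw := Real.exp_pos (2 * τ)
  generalize Real.exp (2 * τ) = w at hw ⊢
  have hlam0 : 0 < lam := by linarith
  have h3 : 1 ≤ lam ^ 3 := one_le_pow₀ hlam.le
  calc w ^ 2 * lam ^ 2 / ((w + lam ^ 3) * (w + lam ^ 2) ^ 2 * (w + lam))
      ≤ (w * (w + lam)) * (w + lam ^ 2) / ((1 + w) * (w + lam ^ 2) ^ 2 * (w + lam)) := by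
        gcongr ?_ / (?_ * _ * _)
        · nlinarith [mul_pos hw hlam0, mul_pos (mul_pos hw hw) hw,
            mul_pos (mul_pos hw hw) hlam0, mul_pos hw (pow_pos hlam0 3)]
        · linarith
    _ = w / ((1 + w) * (w + lam ^ 2)) := by field_simp

lemma hasSum_melnikovKernel {lam : ℝ} (hlam : 1 < lam) (τ : ℝ) :
    HasSum (fun n : ℤ => melnikovKernel lam (τ + n * Real.log lam)) (1 / (lam ^ 2 - 1)) := by
  have hlog : 0 < Real.log lam := Real.log_pos hlam
  have hlam0 : 0 < lam := by linarith
  have h1 : 0 < lam ^ 2 - 1 := by nlinarith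
  let g : ℤ → ℝ := fun n => 2 * (τ + (n - 1) * Real.log lam)
  have hg : Monotone g := fun m n hmn => by
    have : (m : ℝ) ≤ n := by exact_mod_cast hmn
    simp only [g]
    gcongr
  have hgt : Tendsto g atTop atTop := by
    refine Tendsto.const_mul_atTop two_pos (tendsto_atTop_add_const_left _ _ ?_)
    exact (tendsto_atTop_add_const_right _ (-1 : ℝ) tendsto_intCast_atTop_atTop).atTop_mul_const
      hlog
  have hgb : Tendsto g atBot atBot := by
    refine Tendsto.const_mul_atBot two_pos (tendsto_atBot_add_const_left _ _ ?_)
    exact (tendsto_atBot_add_const_right _ (-1 : ℝ) (tendsto_intCast_atBot_iff.2 tendsto_id)).atBot_mul_const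
      hlog
  let f : ℤ → ℝ := fun n => (1 + Real.exp (g n))⁻¹
  have hf : Antitone f := fun m n hmn => by
    have := hg hmn
    simp only [f]
    gcongr
  have hA : Tendsto f atBot (𝓝 1) := by
    simpa [f] using ((Real.tendsto_exp_atBot.comp hgb).const_add 1).inv₀ (by norm_num)
  have hB : Tendsto f atTop (𝓝 0) :=
    tendsto_inv_atTop_zero.comp
      (tendsto_atTop_add_const_left _ _ (Real.tendsto_exp_atTop.comp hgt))
  have hterm : ∀ n : ℤ, melnikovKernel lam (τ + n * Real.log lam)
      = (f n - f (n + 1)) / (lam ^ 2 - 1) := fun n => by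
    have e1 : Real.exp (2 * (τ + n * Real.log lam)) = Real.exp (g n) * lam ^ 2 := by
      rw [← Real.exp_log (pow_pos hlam0 2), ← Real.exp_add, Real.log_pow]
      congr 1
      simp only [g]
      push_cast
      ring
    have e2 : Real.exp (g (n + 1)) = Real.exp (g n) * lam ^ 2 := by
      rw [← e1]
      congr 1
      simp only [g]
      push_cast
      ring
    simp only [melnikovKernel, f, e1, e2]
    have hw := Real.exp_pos (g n)
    generalize Real.exp (g n) = w at hw ⊢
    field_simp
    ring
  simp_rw [hterm]
  simpa only [sub_zero] using
    (hasSum_int_sub_succ_of_antitone hf hA hB).div_const (lam ^ 2 - 1)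

/-- The summand is `a ḃ - b ȧ` times a positive function, plus a difference of two kernels which
have the same sum over the lattice of collisions. -/
lemma melnikovSummand_eq {m b lam v da db : ℝ} (hm : m ≠ 0) (hb : b ≠ 0) (hlam : 0 < lam)
    (hv : v ≠ 0) (τ : ℝ) :
    melnikovSummand (m * (lam + 1)) b (m * (lam - 1)) lam v da db τ =
      (m * (lam + 1) * db - b * da) * (64 * m ^ 2 * lam ^ 2 / (v * b)) *
        (melnikovKernel lam τ + (lam - 1) ^ 2 * melnikovCorrection lam τ) +
      16 * da * lam * m ^ 2 * (lam - 1) ^ 2 / v *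
        (melnikovKernel lam (τ - Real.log lam / 2) - melnikovKernel lam τ) := by
  have e : Real.exp (2 * (τ - Real.log lam / 2)) = Real.exp (2 * τ) / lam := by
    rw [mul_sub, mul_div_cancel₀ _ two_ne_zero, Real.exp_sub, Real.exp_log hlam]
  simp only [melnikovSummand, melnikovKernel, melnikovCorrection, e]
  have hw := Real.exp_pos (2 * τ)
  generalize Real.exp (2 * τ) = w at hw ⊢
  field_simp
  ring

/-- vanishing criterion for the Melnikov function of the
time-dependent ellipse.  With `M₁(τ) = ∑_{n ∈ ℤ} F(τ + n h)`: if
`a·db − b·da = 0` then `M₁ ≡ 0`, and if `a·db − b·da ≠ 0` then `M₁(τ) ≠ 0` for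
every `τ`, with the sign of `M₁(τ)` equal to the sign of `a·db − b·da`
(so the Melnikov function has zeros only at critical points of `a(t)/b(t)`). -/
theorem melnikov_vanishing_criterion
    (a b : ℝ) (hb : 0 < b) (hab : b < a)
    (c lam h : ℝ) (hc : c = Real.sqrt (a ^ 2 - b ^ 2)) (hlam : lam = (a + c) / (a - c))
    (hh : h = Real.log lam)
    (v : ℝ) (hv : 0 < v) (da db : ℝ) :
    (a * db - b * da = 0 →
      ∀ τ : ℝ, (∑' n : ℤ, melnikovSummand a b c lam v da db (τ + n * h)) = 0) ∧
    (a * db - b * da ≠ 0 →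
      ∀ τ : ℝ, (∑' n : ℤ, melnikovSummand a b c lam v da db (τ + n * h)) ≠ 0 ∧
        0 < (a * db - b * da) * ∑' n : ℤ, melnikovSummand a b c lam v da db (τ + n * h)) := by
  have hc0 : 0 < c := by rw [hc]; exact Real.sqrt_pos.2 (by nlinarith)
  have hca : c < a := by
    rw [hc, Real.sqrt_lt' (by linarith)]
    nlinarith
  have hac : 0 < a - c := by linarith
  have hlam1 : 1 < lam := by rw [hlam, lt_div_iff₀ hac]; linarith
  have hlam0 : 0 < lam := by linarith
  obtain ⟨m, hm, ha_eq, hc_eq⟩ : ∃ m : ℝ, 0 < m ∧ a = m * (lam + 1) ∧ c = m * (lam - 1) := by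
    refine ⟨(a - c) / 2, by linarith, ?_, ?_⟩ <;> rw [hlam] <;> field_simp <;> ring
  have key : ∀ τ : ℝ, ∃ S : ℝ, 0 < S ∧
      (∑' n : ℤ, melnikovSummand a b c lam v da db (τ + n * h)) = (a * db - b * da) * S := by
    intro τ
    have hK := hasSum_melnikovKernel hlam1 τ
    have hK' := hasSum_melnikovKernel hlam1 (τ - Real.log lam / 2)
    have hC : Summable fun n : ℤ => melnikovCorrection lam (τ + n * Real.log lam) :=
      hK.summable.of_nonneg_of_le (fun _ => melnikovCorrection_nonneg hlam0 _)
        (fun _ => melnikovCorrection_le_kernel hlam1 _)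
    have hS := ((hK.add (hC.hasSum.mul_left ((lam - 1) ^ 2))).mul_left
      ((a * db - b * da) * (64 * m ^ 2 * lam ^ 2 / (v * b)))).add
      ((hK'.sub hK).mul_left (16 * da * lam * m ^ 2 * (lam - 1) ^ 2 / v))
    have hC0 : 0 ≤ ∑' n : ℤ, melnikovCorrection lam (τ + n * Real.log lam) :=
      tsum_nonneg fun _ => melnikovCorrection_nonneg hlam0 _
    have h1 : 0 < lam ^ 2 - 1 := by nlinarith
    refine ⟨64 * m ^ 2 * lam ^ 2 / (v * b) * (1 / (lam ^ 2 - 1) + (lam - 1) ^ 2 *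
      ∑' n : ℤ, melnikovCorrection lam (τ + n * Real.log lam)), by positivity, ?_⟩
    refine (tsum_congr fun n => ?_).trans (hS.tsum_eq.trans ?_)
    · rw [hh, ha_eq, hc_eq, melnikovSummand_eq hm.ne' hb.ne' hlam0 hv.ne', sub_add_eq_add_sub]
    · ring
  refine ⟨fun h0 τ => ?_, fun h0 τ => ?_⟩ <;> obtain ⟨S, hS, hsum⟩ := key τ <;> rw [hsum]
  · rw [h0, zero_mul]
  · exact ⟨mul_ne_zero h0 hS.ne', by rw [← mul_assoc]; exact mul_pos (mul_self_pos.2 h0) hS⟩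
end
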